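/- arXiv:math/0110134 — 2 statements merged into one kernel-verified Lean document; each statement's English description precedes it below -/
import Mathlib

section
/- Let h be a homogeneous Hamiltonian on T'ℝ^d with complete flow Φ. Let γ : [0, 1] → T'ℝ^d be a C^∞ path and let T : [0, 1] → (0, ∞) be a continuous function such that Φ(T(s); γ(s)) = γ(s) for every s ∈ [0, 1] (every point of γ is periodic with period T(s)). Then T is constant on [0, 1]. -/
open Real Set Filter MeasureTheory
open scoped BigOperators Topology

noncomputable section

/-- The phase space `ℝ^d × ℝ^d`. -/
abbrev Phase (d : ℕ) := (Fin d → ℝ) × (Fin d → ℝ)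

/-- `T'ℝ^d = ℝ^d × (ℝ^d ∖ {0})`. -/
def Tprime (d : ℕ) : Set (Phase d) := {p | p.2 ≠ 0}

/-- The Hamiltonian vector field `(∂h/∂ξ, −∂h/∂x)` of `h`. -/
def hamField {d : ℕ} (h : Phase d → ℝ) (p : Phase d) : Phase d :=
  (fun j => fderiv ℝ h p (0, Pi.single j 1), fun j => - fderiv ℝ h p (Pi.single j 1, 0))

/-- `γ` solves Hamilton's equations `ẋ = h_ξ`, `ξ̇ = −h_x` on the set `I`. -/
def IsHamTrajOn {d : ℕ} (h : Phase d → ℝ) (γ : ℝ → Phase d) (I : Set ℝ) : Prop :=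
  ∀ t ∈ I, HasDerivAt γ (hamField h (γ t)) t

/-- `h` is a homogeneous Hamiltonian: smooth and positive on `T'ℝ^d`, and positively
homogeneous of degree 1 in `ξ`. -/
def HomHamiltonian {d : ℕ} (h : Phase d → ℝ) : Prop :=
  ContDiffOn ℝ (⊤ : ℕ∞) h (Tprime d) ∧
  (∀ p ∈ Tprime d, 0 < h p) ∧
  (∀ p ∈ Tprime d, ∀ c : ℝ, 0 < c → h (p.1, c • p.2) = c * h p)

/-- `Φ` is the complete flow of `h` on `T'ℝ^d`: it is smooth in `(t, y, η)`, starts at the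
identity, stays in `T'ℝ^d`, solves Hamilton's equations for all time, and is the unique such
trajectory through each point. -/
def IsCompleteFlow {d : ℕ} (h : Phase d → ℝ) (Φ : ℝ → Phase d → Phase d) : Prop :=
  ContDiffOn ℝ (⊤ : ℕ∞) (fun q : ℝ × Phase d => Φ q.1 q.2) (Set.univ ×ˢ Tprime d) ∧
  ∀ p ∈ Tprime d,
    Φ 0 p = p ∧ (∀ t : ℝ, Φ t p ∈ Tprime d) ∧
    IsHamTrajOn h (fun t => Φ t p) Set.univ ∧
    (∀ γ : ℝ → Phase d, γ 0 = p → (∀ t : ℝ, γ t ∈ Tprime d) →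
      IsHamTrajOn h γ Set.univ → γ = fun t => Φ t p)

/-- The function `(y, η) ↦ |x*(T; y, η) − y|² + |ξ*(T; y, η) − η|²`. -/
def periodDefect {d : ℕ} (Φ : ℝ → Phase d → Phase d) (T : ℝ) (p : Phase d) : ℝ :=
  (∑ j, ((Φ T p).1 j - p.1 j) ^ 2) + (∑ j, ((Φ T p).2 j - p.2 j) ^ 2)

/-- `p₀ ∈ T'ℝ^d` is absolutely `T`-periodic: the period defect vanishes to infinite
order at `p₀`. -/
def AbsPeriodic {d : ℕ} (Φ : ℝ → Phase d → Phase d) (T : ℝ) (p₀ : Phase d) : Prop :=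
  p₀ ∈ Tprime d ∧
  ∀ n : ℕ, iteratedFDerivWithin ℝ n (periodDefect Φ T) (Tprime d) p₀ = 0

lemma isOpen_Tprime' (d : ℕ) : IsOpen (Tprime d) :=
  isOpen_ne_fun continuous_snd continuous_const

lemma phase_decomp {d : ℕ} (L : Phase d →L[ℝ] ℝ) (w : Phase d) :
    L w = (∑ j, w.1 j * L (Pi.single j 1, 0)) + ∑ j, w.2 j * L (0, Pi.single j 1) := by
  have h1 : ∀ u : Fin d → ℝ, u = ∑ j, u j • (Pi.single j (1:ℝ) : Fin d → ℝ) := by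
    intro u
    ext i
    simp [Finset.sum_apply, Pi.single_apply]
  have hw : w = (w.1, 0) + (0, w.2) := by simp
  have e1 : L (w.1, 0) = ∑ j, w.1 j * L (Pi.single j 1, 0) := by
    have := congrArg (L.comp (ContinuousLinearMap.inl ℝ (Fin d → ℝ) (Fin d → ℝ))) (h1 w.1)
    simpa only [map_sum, map_smul, smul_eq_mul, ContinuousLinearMap.comp_apply,
      ContinuousLinearMap.inl_apply] using this
  have e2 : L (0, w.2) = ∑ j, w.2 j * L (0, Pi.single j 1) := by
    have := congrArg (L.comp (ContinuousLinearMap.inr ℝ (Fin d → ℝ) (Fin d → ℝ))) (h1 w.2)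
    simpa only [map_sum, map_smul, smul_eq_mul, ContinuousLinearMap.comp_apply,
      ContinuousLinearMap.inr_apply] using this
  rw [← e1, ← e2, ← map_add, ← hw]

lemma ham_diff {d : ℕ} {h : Phase d → ℝ} (hh : HomHamiltonian h) {p : Phase d}
    (hp : p ∈ Tprime d) : DifferentiableAt ℝ h p :=
  (hh.1.contDiffAt ((isOpen_Tprime' d).mem_nhds hp)).differentiableAt (by simp)

lemma ham_euler {d : ℕ} {h : Phase d → ℝ} (hh : HomHamiltonian h) {p : Phase d}
    (hp : p ∈ Tprime d) : ∑ j, p.2 j * (hamField h p).1 j = h p := by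
  have hd := (ham_diff hh hp).hasFDerivAt
  have hc : HasDerivAt (fun r : ℝ => ((p.1, r • p.2) : Phase d)) (0, (1:ℝ) • p.2) 1 :=
    (hasDerivAt_const _ _).prodMk ((hasDerivAt_id (1:ℝ)).smul_const p.2)
  have h1 : HasDerivAt (fun r : ℝ => h (p.1, r • p.2)) (fderiv ℝ h p (0, (1:ℝ) • p.2)) 1 := by
    have hd' : HasFDerivAt h (fderiv ℝ h p) ((p.1, (1:ℝ) • p.2) : Phase d) := by simpa using hd
    exact hd'.comp_hasDerivAt (1:ℝ) hc
  have h2 : HasDerivAt (fun r : ℝ => h (p.1, r • p.2)) (1 * h p) 1 := by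
    refine ((hasDerivAt_id (1:ℝ)).mul_const (h p)).congr_of_eventuallyEq ?_
    filter_upwards [lt_mem_nhds (zero_lt_one : (0:ℝ) < 1)] with r hr
    exact hh.2.2 p hp r hr
  have h3 := h1.unique h2
  rw [phase_decomp] at h3
  simpa [hamField] using h3

/-- The canonical one-form is invariant under the flow. -/
lemma flow_alpha {d : ℕ} {h : Phase d → ℝ} (hh : HomHamiltonian h)
    {Φ : ℝ → Phase d → Phase d} (hΦ : IsCompleteFlow h Φ) {p : Phase d} (hp : p ∈ Tprime d)
    (v : Phase d) (t : ℝ) :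
    ∑ j, (Φ t p).2 j * (fderiv ℝ (fun q : ℝ × Phase d => Φ q.1 q.2) (t, p) (0, v)).1 j
      = ∑ j, p.2 j * v.1 j := by
  set F : ℝ × Phase d → Phase d := fun q => Φ q.1 q.2 with hF
  have hU : IsOpen ((Set.univ : Set ℝ) ×ˢ Tprime d) := isOpen_univ.prod (isOpen_Tprime' d)
  have hcd : ∀ t : ℝ, ∀ p ∈ Tprime d, ContDiffAt ℝ (⊤ : ℕ∞) F (t, p) := fun t p hp =>
    hΦ.1.contDiffAt (hU.mem_nhds ⟨mem_univ _, hp⟩)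
  have hFd : ∀ t : ℝ, ∀ p ∈ Tprime d, HasFDerivAt F (fderiv ℝ F (t, p)) (t, p) := fun t p hp =>
    ((hcd t p hp).differentiableAt (by simp)).hasFDerivAt
  have hGd : ∀ t : ℝ, HasFDerivAt (fderiv ℝ F) (fderiv ℝ (fderiv ℝ F) (t, p)) (t, p) := fun t =>
    (((hcd t p hp).fderiv_right (m := 1) (by norm_cast)).differentiableAt (by simp)).hasFDerivAt
  have hcurve : ∀ t : ℝ, ∀ p : Phase d,
      HasDerivAt (fun r : ℝ => ((r, p) : ℝ × Phase d)) (1, 0) t := fun t p =>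
    (hasDerivAt_id t).prodMk (hasDerivAt_const _ _)
  have hline : ∀ t : ℝ, HasDerivAt (fun r : ℝ => ((t, p + r • v) : ℝ × Phase d)) (0, v) 0 := by
    intro t
    have := (hasDerivAt_const (0:ℝ) t).prodMk
      (((hasDerivAt_id (0:ℝ)).smul_const v).const_add p)
    simpa using this
  have hlineT : ∀ᶠ r : ℝ in 𝓝 0, p + r • v ∈ Tprime d := by
    have hc : ContinuousAt (fun r : ℝ => p + r • v) 0 := by fun_prop
    apply hc.eventually_mem
    simpa using (isOpen_Tprime' d).mem_nhds hp
  have hX : ∀ t : ℝ, ∀ p ∈ Tprime d, fderiv ℝ F (t, p) (1, 0) = hamField h (Φ t p) := by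
    intro t p hp
    have h1 := (hFd t p hp).comp_hasDerivAt t (hcurve t p)
    exact h1.unique ((hΦ.2 p hp).2.2.1 t (mem_univ _))
  -- coordinate projections
  have hfst : ∀ (f : ℝ → Phase d) (f' : Phase d) (r : ℝ), HasDerivAt f f' r →
      ∀ j, HasDerivAt (fun r => (f r).1 j) (f'.1 j) r := fun f f' r hf j =>
    hasDerivAt_pi.1 (hasFDerivAt_fst.comp_hasDerivAt r hf) j
  have hsnd : ∀ (f : ℝ → Phase d) (f' : Phase d) (r : ℝ), HasDerivAt f f' r →
      ∀ j, HasDerivAt (fun r => (f r).2 j) (f'.2 j) r := fun f f' r hf j =>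
    hasDerivAt_pi.1 (hasFDerivAt_snd.comp_hasDerivAt r hf) j
  have hline0 : ∀ t : ℝ, ((t, p + (0:ℝ) • v) : ℝ × Phase d) = (t, p) := by simp
  have key : ∀ t : ℝ, HasDerivAt
      (fun t => ∑ j, (Φ t p).2 j * (fderiv ℝ F (t, p) (0, v)).1 j) 0 t := by
    intro t
    set D2 := fderiv ℝ (fderiv ℝ F) (t, p)
    have hsymm : D2 (1, 0) (0, v) = D2 (0, v) (1, 0) :=
      ((hcd t p hp).isSymmSndFDerivAt (by simp; exact WithTop.coe_le_coe.2 (le_top : (2:ℕ∞) ≤ ⊤))) _ _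
    -- derivative of A
    have a1 : HasDerivAt (fun r => F (r, p)) (fderiv ℝ F (t, p) (1, 0)) t := by
      have := (hFd t p hp).comp_hasDerivAt t (hcurve t p)
      exact this
    have a2 : HasDerivAt (fun r => fderiv ℝ F (r, p) (0, v)) (D2 (1, 0) (0, v)) t := by
      have := (hGd t).comp_hasDerivAt t (hcurve t p)
      simpa using this.clm_apply (hasDerivAt_const t ((0, v) : ℝ × Phase d))
    have A := HasDerivAt.fun_sum (u := Finset.univ)
      (fun j _ => (hsnd _ _ _ a1 j).mul (hfst _ _ _ a2 j))
    -- derivative of B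
    have b1 : HasDerivAt (fun r : ℝ => F (t, p + r • v)) (fderiv ℝ F (t, p) (0, v)) 0 := by
      have := hFd t p hp
      rw [← hline0] at this
      have := this.comp_hasDerivAt 0 (hline t)
      rwa [hline0] at this
    have b2 : HasDerivAt (fun r : ℝ => fderiv ℝ F (t, p + r • v) (1, 0)) (D2 (0, v) (1, 0)) 0 := by
      have := hGd t
      rw [← hline0] at this
      have := this.comp_hasDerivAt 0 (hline t)
      rw [hline0] at this
      simpa using this.clm_apply (hasDerivAt_const (0:ℝ) ((1, 0) : ℝ × Phase d))
    have B := HasDerivAt.fun_sum (u := Finset.univ)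
      (fun j _ => (hsnd _ _ _ b1 j).mul (hfst _ _ _ b2 j))
    have hpt := (hΦ.2 p hp).2.1 t
    have C : HasDerivAt (fun r : ℝ => h (F (t, p + r • v)))
        (fderiv ℝ h (Φ t p) (fderiv ℝ F (t, p) (0, v))) 0 := by
      have := (ham_diff hh hpt).hasFDerivAt
      have e : Φ t p = F (t, p + (0:ℝ) • v) := by simp [hF]
      rw [e] at this ⊢
      exact this.comp_hasDerivAt (0:ℝ) b1
    have BC := B.unique (C.congr_of_eventuallyEq (by
      filter_upwards [hlineT] with r hr
      simp only [Pi.mul_apply]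
      rw [hX t _ hr]
      exact ham_euler hh ((hΦ.2 _ hr).2.1 t)))
    rw [phase_decomp] at BC
    refine A.congr_deriv ?_
    simp only [hline0, hX t p hp] at BC ⊢
    rw [hsymm, Finset.sum_add_distrib]
    rw [Finset.sum_add_distrib] at BC
    simp only [hamField, neg_mul, Finset.sum_neg_distrib] at BC ⊢
    have e1 : ∀ a b : Fin d → ℝ, ∑ j, a j * b j = ∑ j, b j * a j := fun a b =>
      Finset.sum_congr rfl fun j _ => mul_comm _ _
    have e2 := e1 (fun j => (fderiv ℝ F (t, p) (0, v)).1 j)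
      (fun j => fderiv ℝ h (Φ t p) (Pi.single j 1, 0))
    linarith
  have hconst := is_const_of_deriv_eq_zero (fun t => (key t).differentiableAt)
    (fun t => (key t).deriv) t 0
  rw [hconst, (hΦ.2 p hp).1]
  have z1 : HasDerivAt (fun r : ℝ => F (0, p + r • v)) (fderiv ℝ F (0, p) (0, v)) 0 := by
    have := hFd 0 p hp
    rw [← hline0] at this
    have := this.comp_hasDerivAt 0 (hline 0)
    rwa [hline0] at this
  have z2 : HasDerivAt (fun r : ℝ => F (0, p + r • v)) v 0 := by
    have : HasDerivAt (fun r : ℝ => p + r • v) v 0 := by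
      simpa using ((hasDerivAt_id (0:ℝ)).smul_const v).const_add p
    refine this.congr_of_eventuallyEq ?_
    filter_upwards [hlineT] with r hr
    exact (hΦ.2 _ hr).1
  rw [z1.unique z2]

/-- If every point of a smooth path `γ` in `T'ℝ^d` is periodic with period `T(s)` depending
continuously on `s`, then the period is constant along the path. -/
theorem period_constant_along_path {d : ℕ} (h : Phase d → ℝ)
    (hh : HomHamiltonian h) (Φ : ℝ → Phase d → Phase d) (hΦ : IsCompleteFlow h Φ)
    (γ : ℝ → Phase d) (hγ : ContDiffOn ℝ (⊤ : ℕ∞) γ (Set.Icc 0 1))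
    (hγT' : ∀ s ∈ Set.Icc (0 : ℝ) 1, γ s ∈ Tprime d)
    (T : ℝ → ℝ) (hTcont : ContinuousOn T (Set.Icc 0 1))
    (hTpos : ∀ s ∈ Set.Icc (0 : ℝ) 1, 0 < T s)
    (hper : ∀ s ∈ Set.Icc (0 : ℝ) 1, Φ (T s) (γ s) = γ s) :
    ∀ s ∈ Set.Icc (0 : ℝ) 1, T s = T 0 := by
  have hderiv : ∀ s₀ ∈ Set.Icc (0:ℝ) 1, HasDerivWithinAt T 0 (Set.Icc 0 1) s₀ := by
    intro s₀ hs₀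
    set p := γ s₀ with hpdef
    have hp : p ∈ Tprime d := hγT' s₀ hs₀
    set F : ℝ × Phase d → Phase d := fun q => Φ q.1 q.2 with hF
    have hU : IsOpen ((Set.univ : Set ℝ) ×ˢ Tprime d) := isOpen_univ.prod (isOpen_Tprime' d)
    have hFd : HasFDerivAt F (fderiv ℝ F (T s₀, p)) (T s₀, p) :=
      ((hΦ.1.contDiffAt (hU.mem_nhds ⟨mem_univ _, hp⟩)).differentiableAt (by simp)).hasFDerivAt
    set L := fderiv ℝ F (T s₀, p)
    have hγd : DifferentiableWithinAt ℝ γ (Set.Icc 0 1) s₀ :=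
      (hγ s₀ hs₀).differentiableWithinAt (by simp)
    have htend : Tendsto (fun s => ((T s, γ s) : ℝ × Phase d)) (𝓝[Set.Icc 0 1] s₀)
        (𝓝 (T s₀, p)) :=
      (hTcont s₀ hs₀).prodMk_nhds hγd.continuousWithinAt
    have h1 := hFd.isLittleO.comp_tendsto htend
    let ℓ : Phase d →L[ℝ] ℝ :=
      ∑ j, p.2 j • ((ContinuousLinearMap.proj j).comp (ContinuousLinearMap.fst ℝ _ _))
    have hℓ : ∀ w, ℓ w = ∑ j, p.2 j * w.1 j := by
      intro w
      simp [ℓ]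
    have h2 := (ℓ.isBigO_comp _ _).trans_isLittleO h1
    have hLt : ℓ (L (1, 0)) = h p := by
      have hX : L (1, 0) = hamField h p := by
        have hc : HasDerivAt (fun r : ℝ => ((r, p) : ℝ × Phase d)) (1, 0) (T s₀) :=
          (hasDerivAt_id _).prodMk (hasDerivAt_const _ _)
        have h1 := hFd.comp_hasDerivAt (T s₀) hc
        have := h1.unique ((hΦ.2 p hp).2.2.1 (T s₀) (mem_univ _))
        simpa [hper s₀ hs₀, hpdef] using this
      rw [hX, hℓ, ham_euler hh hp]
    have hLv : ∀ v, ℓ (L (0, v)) = ℓ v := by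
      intro v
      have := flow_alpha hh hΦ hp v (T s₀)
      rw [hper s₀ hs₀] at this
      rw [hℓ, hℓ]
      exact this
    have h3 : (fun s => (T s - T s₀) * h p) =o[𝓝[Set.Icc 0 1] s₀]
        (fun s => ((T s, γ s) : ℝ × Phase d) - (T s₀, p)) := by
      refine (h2.neg_left).congr' ?_ (Eventually.of_forall fun s => rfl)
      filter_upwards [self_mem_nhdsWithin] with s hs
      have e : ((T s, γ s) : ℝ × Phase d) - (T s₀, p)
          = (T s - T s₀) • ((1, 0) : ℝ × Phase d) + (0, γ s - p) := by
        ext <;> simp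
      have e1 : F (T s, γ s) = γ s := hper s hs
      have e2 : F (T s₀, p) = p := hper s₀ hs₀
      simp only [Function.comp_apply]
      rw [e1, e2, e, map_add, map_smul, map_sub, map_add, map_smul, hLt, hLv, smul_eq_mul]
      ring
    have hpos := hh.2.1 p hp
    have h4 : (fun s => T s - T s₀) =o[𝓝[Set.Icc 0 1] s₀]
        (fun s => ((T s, γ s) : ℝ × Phase d) - (T s₀, p)) := by
      refine (h3.const_mul_left (h p)⁻¹).congr_left fun s => ?_
      field_simp
    have h5 : (fun s => T s - T s₀) =o[𝓝[Set.Icc 0 1] s₀] (fun s => γ s - p) := by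
      rw [Asymptotics.isLittleO_iff] at h4 ⊢
      intro c hc
      have hc' : 0 < min c (1/2) := by positivity
      filter_upwards [h4 hc'] with s hs
      have e : ‖((T s, γ s) : ℝ × Phase d) - (T s₀, p)‖ = max ‖T s - T s₀‖ ‖γ s - p‖ := rfl
      rw [e] at hs
      have m1 := min_le_left c (1/2)
      have m2 := min_le_right c (1/2)
      have n1 := norm_nonneg (T s - T s₀)
      have n2 := norm_nonneg (γ s - p)
      rcases max_cases ‖T s - T s₀‖ ‖γ s - p‖ with ⟨h, _⟩ | ⟨h, _⟩
      · rw [h] at hs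
        have : ‖T s - T s₀‖ = 0 := by nlinarith
        rw [this]; positivity
      · rw [h] at hs
        nlinarith
    have h6 := h5.trans_isBigO hγd.isBigO_sub
    rw [hasDerivWithinAt_iff_isLittleO]
    simpa using h6
  intro s hs
  refine (convex_Icc (0:ℝ) 1).is_const_of_fderivWithin_eq_zero
    (fun x hx => (hderiv x hx).differentiableWithinAt) ?_ hs (by simp)
  intro x hx
  have := (hderiv x hx).hasFDerivWithinAt.fderivWithin
    (uniqueDiffOn_Icc zero_lt_one x hx)
  rw [this]; ext; simp
end
end

section
/- Let N, M ≥ 1 and let F : ℝ^N → ℝ^M be a C^∞ map. Then the set of zeros of F which are not infinite-order zeros of F has Lebesgue measure zero; equivalently, for Lebesgue-almost every point x with F(x) = 0, all partial derivatives of F of all orders vanish at x. -/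
open Real Set Filter MeasureTheory
open scoped BigOperators Topology

noncomputable section

lemma aux_fderiv {N : ℕ} (hN : 1 ≤ N) {G : Type} [NormedAddCommGroup G] [NormedSpace ℝ G]
    [FiniteDimensional ℝ G] (g : (Fin N → ℝ) → G) (hg : Differentiable ℝ g) :
    ∀ᵐ x : Fin N → ℝ, g x = 0 → fderiv ℝ g x = 0 := by
  have hs : MeasurableSet {x | g x = 0} :=
    (isClosed_eq hg.continuous continuous_const).measurableSet
  let b := Module.finBasis ℝ G
  have key : ∀ i, ∀ᵐ x : Fin N → ℝ, g x = 0 → ∀ v, b.repr (fderiv ℝ g x v) i = 0 := by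
    intro i
    let φ : G →L[ℝ] ℝ := LinearMap.toContinuousLinearMap (b.coord i)
    let L : ℝ →L[ℝ] (Fin N → ℝ) := ContinuousLinearMap.toSpanSingleton ℝ (fun _ => (1 : ℝ))
    have h1 : ApproximatesLinearOn (fun x => L (φ (g x))) (0 : (Fin N → ℝ) →L[ℝ] (Fin N → ℝ))
        {x | g x = 0} 0 := by
      intro x hx y hy
      simp only [mem_setOf_eq] at hx hy
      simp [hx, hy]
    have h2 := h1.norm_fderiv_sub_le volume hs (fun x => (L.comp φ).comp (fderiv ℝ g x))
      (fun x _ => (((L.comp φ).hasFDerivAt).comp x (hg x).hasFDerivAt).hasFDerivWithinAt)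
    rw [ae_restrict_iff' hs] at h2
    filter_upwards [h2] with x hx h0 v
    have h3 := hx h0
    simp only [sub_zero, nonpos_iff_eq_zero, nnnorm_eq_zero] at h3
    have h4 := congrFun (congrArg (fun A => A v) h3) ⟨0, hN⟩
    simpa [L, φ] using h4
  filter_upwards [ae_all_iff.2 key] with x hx h0
  ext v
  apply b.repr.injective
  ext i
  simpa using hx i h0 v

lemma aux_iter {N : ℕ} (hN : 1 ≤ N) (n : ℕ) : ∀ {G : Type} [NormedAddCommGroup G]
    [NormedSpace ℝ G] [FiniteDimensional ℝ G] (g : (Fin N → ℝ) → G)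
    (_ : ContDiff ℝ (⊤ : ℕ∞) g),
    ∀ᵐ x : Fin N → ℝ, g x = 0 → iteratedFDeriv ℝ n g x = 0 := by
  induction n with
  | zero =>
    intro G _ _ _ g hg
    filter_upwards with x hx
    rw [← norm_eq_zero, norm_iteratedFDeriv_zero, hx, norm_zero]
  | succ n ih =>
    intro G _ _ _ g hg
    have h1 : ContDiff ℝ (⊤ : ℕ∞) (fderiv ℝ g) := hg.fderiv_right (by simp)
    filter_upwards [aux_fderiv hN g (hg.differentiable (by simp)), ih (fderiv ℝ g) h1]
      with x hx hx' h0
    rw [← norm_eq_zero, ← norm_iteratedFDeriv_fderiv, hx' (hx h0), norm_zero]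

/-- For a `C^∞` map `F`, the set of zeros of `F` which are not infinite-order zeros has
Lebesgue measure zero. -/
theorem zeros_not_infinite_order_measure_zero {N M : ℕ} (hN : 1 ≤ N) (hM : 1 ≤ M)
    (F : (Fin N → ℝ) → (Fin M → ℝ)) (hF : ContDiff ℝ (⊤ : ℕ∞) F) :
    volume {x : Fin N → ℝ | F x = 0 ∧ ∃ n : ℕ, iteratedFDeriv ℝ n F x ≠ 0} = 0 := by
  have h := ae_all_iff.2 (fun n => aux_iter hN n F hF)
  refine measure_mono_null ?_ (ae_iff.1 h)
  rintro x ⟨h0, n, hn⟩ hx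
  exact hn (hx n h0)
end
end
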